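/- Let K be a Volterra kernel on [0,T]² satisfying Condition (A) with parameter α∈[0,1/4), let E be a Banach space, let φ:[0,T]→E be λ-Hölder continuous with λ>α, and suppose that for each s, the map r ↦ K(r,s) is absolutely continuous on (s,T]. Then for every a∈[0,T] and every s∈(0,T), K*(φ·𝟙_{[0,a)})(s) = 𝟙_{[0,a)}(s)·( φ(s)K(a,s) + ∫_s^a [φ(r)−φ(s)] (∂K(r,s)/∂r) dr ). -/

import Mathlib

open MeasureTheory Set

noncomputable section

/-- Condition (A) on a Volterra kernel `K` on `[0,T]²`, with `K'` the partial derivative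
`∂K(t,s)/∂t`. -/
def VolterraCondA (T : ℝ) (K K' : ℝ → ℝ → ℝ) (α : ℝ) : Prop :=
  IntegrableOn (fun p : ℝ × ℝ => (K p.1 p.2) ^ 2) (Icc 0 T ×ˢ Icc 0 T) ∧
  (∀ s t : ℝ, t ≤ s → K t s = 0) ∧
  ∃ C : ℝ, ∀ s t : ℝ, 0 < s → s < t → t ≤ T →
    |K t s| ≤ C * s ^ (-α) * (t - s) ^ (-α) ∧
    HasDerivAt (fun r => K r s) (K' t s) t ∧
    |K' t s| ≤ C * (t - s) ^ (-(α + 1))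

/-- The operator `K*` acting on a one-parameter function `φ`:
`(K*φ)(s) := φ(s) K(T,s) + ∫_s^T [φ(r) − φ(s)] ∂K(r,s)/∂r dr`. -/
def Kstar {E : Type*} [NormedAddCommGroup E] [NormedSpace ℝ E]
    (T : ℝ) (K K' : ℝ → ℝ → ℝ) (φ : ℝ → E) (s : ℝ) : E :=
  K T s • φ s + ∫ r in Ioc s T, K' r s • (φ r - φ s)

/-- A function satisfying a Hölder bound of positive order on a set is continuous there. -/
theorem continuousOn_of_norm_sub_le_mul_rpow {E : Type*} [NormedAddCommGroup E]
    {φ : ℝ → E} {S : Set ℝ} {C lam : ℝ} (hlam : 0 < lam)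
    (hφ : ∀ t₁ t₂ : ℝ, t₁ ∈ S → t₂ ∈ S → ‖φ t₁ - φ t₂‖ ≤ C * |t₁ - t₂| ^ lam) :
    ContinuousOn φ S := by
  intro x hx
  have hlim : Filter.Tendsto (fun t => C * |t - x| ^ lam) (nhdsWithin x S) (nhds 0) := by
    have hc : Continuous fun t : ℝ => C * |t - x| ^ lam :=
      continuous_const.mul
        ((continuous_id.sub continuous_const).abs.rpow_const fun _ => Or.inr hlam.le)
    have h := hc.tendsto x
    simp only [sub_self, abs_zero, Real.zero_rpow hlam.ne', mul_zero] at h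
    exact h.mono_left nhdsWithin_le_nhds
  refine tendsto_iff_norm_sub_tendsto_zero.2
    (squeeze_zero' (Filter.Eventually.of_forall fun _ => norm_nonneg _) ?_ hlim)
  filter_upwards [self_mem_nhdsWithin] with t ht using hφ t x ht hx

/-- Translated powers of exponent greater than `-1` are integrable near their singularity. -/
theorem integrableOn_sub_rpow {s a p : ℝ} (hp : -1 < p) :
    IntegrableOn (fun r : ℝ => (r - s) ^ p) (Ioc s a) := by
  rcases le_total a s with h | h
  · simp [Ioc_eq_empty (not_lt.2 h)]
  · have hi := (intervalIntegral.intervalIntegrable_rpow' (a := 0) (b := a - s) hp).comp_sub_right s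
    simp only [zero_add, sub_add_cancel] at hi
    exact (intervalIntegrable_iff_integrableOn_Ioc_of_le h).1 hi

/-- A derivative is strongly measurable on every measurable set where it exists. -/
theorem aestronglyMeasurable_of_hasDerivAt {f f' : ℝ → ℝ} {S : Set ℝ} (hS : MeasurableSet S)
    (hf : ∀ r ∈ S, HasDerivAt f (f' r) r) :
    AEStronglyMeasurable f' (volume.restrict S) :=
  (measurable_deriv f).aestronglyMeasurable.congr <|
    (ae_restrict_mem hS).mono fun r hr => (hf r hr).deriv

/-- If `K` satisfies Condition (A) with `α ∈ [0,1/4)`, `φ : [0,T] → E` is `λ`-Hölder continuous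
with `λ > α`, and for each `s` the map `r ↦ K(r,s)` is absolutely continuous on `(s,T]` (with
derivative `K'`), then for every `a ∈ [0,T]` and `s ∈ (0,T)`:
`K*(φ·𝟙_{[0,a)})(s) = 𝟙_{[0,a)}(s) ( φ(s)K(a,s) + ∫_s^a [φ(r) − φ(s)] ∂K(r,s)/∂r dr )`. -/
theorem Kstar_truncated_formula
    {E : Type*} [NormedAddCommGroup E] [NormedSpace ℝ E] [CompleteSpace E]
    (T : ℝ) (hT : 0 < T) (K K' : ℝ → ℝ → ℝ) (α : ℝ) (hα0 : 0 ≤ α) (hα : α < 1 / 4)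
    (hK : VolterraCondA T K K' α)
    (lam : ℝ) (hlam : α < lam)
    (φ : ℝ → E) (Cφ : ℝ)
    (hφ : ∀ t₁ t₂ : ℝ, t₁ ∈ Icc (0:ℝ) T → t₂ ∈ Icc (0:ℝ) T →
      ‖φ t₁ - φ t₂‖ ≤ Cφ * |t₁ - t₂| ^ lam)
    -- absolute continuity of `r ↦ K(r,s)` on `(s,T]`, in fundamental-theorem-of-calculus form
    (hAC : ∀ s ∈ Ioo (0:ℝ) T, ∀ b c : ℝ, s < b → b ≤ c → c ≤ T →
      K c s - K b s = ∫ r in Ioc b c, K' r s) :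
    ∀ a ∈ Icc (0:ℝ) T, ∀ s ∈ Ioo (0:ℝ) T,
      Kstar T K K' (fun r => Set.indicator (Ico (0:ℝ) a) φ r) s
        = Set.indicator (Ico (0:ℝ) a)
            (fun s' => K a s' • φ s' + ∫ r in Ioc s' a, K' r s' • (φ r - φ s')) s := by
  obtain ⟨-, -, C, hC⟩ := hK
  intro a ⟨ha0, haT⟩ s hs
  obtain ⟨hs0, hsT⟩ := hs
  have hmeas : AEStronglyMeasurable (fun r => K' r s) (volume.restrict (Ioc s T)) :=
    aestronglyMeasurable_of_hasDerivAt measurableSet_Ioc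
      fun r hr => (hC s r hs0 hr.1 hr.2).2.1
  rcases le_or_gt a s with has | hsa
  · have hzero : ∀ r, s ≤ r → indicator (Ico (0:ℝ) a) φ r = 0 := fun r hr =>
      indicator_of_notMem (fun h => (has.trans hr).not_gt h.2) _
    have hint : ∫ r in Ioc s T,
        K' r s • (indicator (Ico (0:ℝ) a) φ r - indicator (Ico (0:ℝ) a) φ s) = 0 := by
      refine setIntegral_eq_zero_of_forall_eq_zero fun r hr => ?_
      rw [hzero r hr.1.le, hzero s le_rfl, sub_zero, smul_zero]
    rw [indicator_of_notMem (fun h => has.not_gt h.2)]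
    unfold Kstar
    rw [hint, add_zero]
    beta_reduce
    rw [hzero s le_rfl, smul_zero]
  have hs_mem : s ∈ Ico (0:ℝ) a := ⟨hs0.le, hsa⟩
  have hcont : ContinuousOn φ (Icc 0 T) :=
    continuousOn_of_norm_sub_le_mul_rpow (hα0.trans_lt hlam) hφ
  have hsub : Ioc s a ⊆ Ioc s T := Ioc_subset_Ioc_right haT
  have hnear : IntegrableOn (fun r => K' r s • (φ r - φ s)) (Ioc s a) := by
    refine Integrable.mono' ((integrableOn_sub_rpow (s := s) (a := a)
      (p := -(α + 1) + lam) (by linarith)).const_mul (C * Cφ)) ?_ ?_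
    · refine (hmeas.mono_set hsub).smul (AEStronglyMeasurable.sub ?_ aestronglyMeasurable_const)
      exact (hcont.mono fun r hr => ⟨hs0.le.trans hr.1.le, hr.2.trans haT⟩).aestronglyMeasurable
        measurableSet_Ioc
    · filter_upwards [ae_restrict_mem measurableSet_Ioc] with r hr
      have hpos : 0 < r - s := sub_pos.2 hr.1
      have h1 := (hC s r hs0 hr.1 (hr.2.trans haT)).2.2
      have h2 := hφ r s ⟨hs0.le.trans hr.1.le, hr.2.trans haT⟩ ⟨hs0.le, hsT.le⟩
      rw [abs_of_pos hpos] at h2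
      rw [norm_smul, Real.norm_eq_abs, Real.rpow_add hpos, mul_mul_mul_comm]
      exact mul_le_mul h1 h2 (norm_nonneg _) ((abs_nonneg _).trans h1)
  have hfar : IntegrableOn (fun r => K' r s) (Ioc a T) := by
    refine Integrable.of_bound (hmeas.mono_set (Ioc_subset_Ioc_left hsa.le))
      (|C| * (a - s) ^ (-(α + 1))) ?_
    filter_upwards [ae_restrict_mem measurableSet_Ioc] with r hr
    refine (hC s r hs0 (hsa.trans hr.1) hr.2).2.2.trans (mul_le_mul (le_abs_self C) ?_
      (Real.rpow_nonneg (sub_nonneg.2 (hsa.trans hr.1).le) _) (abs_nonneg C))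
    exact Real.rpow_le_rpow_of_nonpos (sub_pos.2 hsa) (by linarith [hr.1]) (by linarith)
  have hnear_ae : (fun r => K' r s • (φ r - φ s)) =ᵐ[volume.restrict (Ioc s a)]
      fun r => K' r s • (indicator (Ico (0:ℝ) a) φ r - φ s) := by
    filter_upwards [ae_restrict_mem measurableSet_Ioc,
      ae_restrict_of_ae (Measure.ae_ne volume a)] with r hr hra
    have hra_mem : r ∈ Ico 0 a := ⟨hs0.le.trans hr.1.le, lt_of_le_of_ne hr.2 hra⟩
    rw [indicator_of_mem hra_mem]
  have hfar_eq : EqOn (fun r => K' r s • -φ s)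
      (fun r => K' r s • (indicator (Ico (0:ℝ) a) φ r - φ s)) (Ioc a T) := fun r hr => by
    simp only [indicator_of_notMem (fun h => hr.1.not_gt h.2 : r ∉ Ico 0 a), zero_sub]
  rw [indicator_of_mem hs_mem]
  unfold Kstar
  simp only [indicator_of_mem hs_mem]
  rw [← Ioc_union_Ioc_eq_Ioc hsa.le haT,
    setIntegral_union (Ioc_disjoint_Ioc_of_le le_rfl) measurableSet_Ioc
      (hnear.congr hnear_ae) (IntegrableOn.congr_fun (hfar.smul_const (-φ s)) hfar_eq measurableSet_Ioc),
    ← integral_congr_ae hnear_ae, ← setIntegral_congr_fun measurableSet_Ioc hfar_eq,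
    integral_smul_const, ← hAC s ⟨hs0, hsT⟩ a T hsa haT le_rfl, smul_neg, sub_smul]
  abel

end
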